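/- Let ρ > 0 and k ∈ (0,1). Suppose γ^r ∈ (0,1) is such that some stationary distributions π_r (full flexibility) and p_r (partial flexibility) with parameters (ρ, k, γ^r) satisfy T_fs(π_r) = T_ps(p_r). Then for every γ with kρ/(kρ+1) < γ < γ^r, and for any stationary distributions π (full flexibility) and p (partial flexibility) with parameters (ρ, k, γ), the partial flexibility system is optimal: T_ps(p) > T_fs(π) and T_ps(p) > T_is, where T_is = ρ/(ρ+1) + kρ/(kρ+1). -/

import Mathlib

/-- The balance equations of the full flexibility system with parameters `ρ`, `k`, `γ`. -/
def FullBalance (ρ k γ : ℝ) (π : Fin 3 → Fin 3 → ℝ) : Prop :=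
  (ρ + k*ρ) * π 0 0 = π 1 0 + γ * π 0 1 + π 0 2 + γ * π 2 0 ∧
  (ρ + k*ρ + 1) * π 1 0 = ρ * π 0 0 + γ * π 1 1 + π 1 2 ∧
  (ρ + k*ρ + γ) * π 2 0 = γ * π 2 1 + π 2 2 ∧
  (ρ + k*ρ + γ) * π 0 1 = π 1 1 + γ * π 2 1 ∧
  (1 + γ) * π 1 1 = ρ * π 1 0 + ρ * π 0 1 ∧
  2 * γ * π 2 1 = ρ * π 2 0 + k*ρ * π 0 1 ∧
  (ρ + k*ρ + 1) * π 0 2 = k*ρ * π 0 0 + π 1 2 + γ * π 2 2 ∧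
  2 * π 1 2 = ρ * π 0 2 + k*ρ * π 1 0 ∧
  (γ + 1) * π 2 2 = k*ρ * π 2 0 + k*ρ * π 0 2

/-- `π` is a stationary distribution of the full flexibility system. -/
def FullStationary (ρ k γ : ℝ) (π : Fin 3 → Fin 3 → ℝ) : Prop :=
  (∀ i j, 0 ≤ π i j) ∧ (∑ i : Fin 3, ∑ j : Fin 3, π i j) = 1 ∧ FullBalance ρ k γ π

/-- Throughput of the full flexibility system. -/
noncomputable def Tfs (ρ k : ℝ) (π : Fin 3 → Fin 3 → ℝ) : ℝ :=
  (k + 1) * ρ * (1 - π 1 1 - π 1 2 - π 2 1 - π 2 2)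

/-- The balance equations of the partial flexibility system with parameters `ρ`, `k`, `γ`. -/
def PartialBalance (ρ k γ : ℝ) (p : Fin 2 → Fin 3 → ℝ) : Prop :=
  (ρ + k*ρ) * p 0 0 = p 1 0 + γ * p 0 1 + p 0 2 ∧
  (ρ + k*ρ + 1) * p 1 0 = ρ * p 0 0 + γ * p 1 1 + p 1 2 ∧
  2 * p 1 2 = ρ * p 0 2 + k*ρ * p 1 0 ∧
  (ρ + 1) * p 0 2 = k*ρ * p 0 0 + p 1 2 ∧
  (1 + γ) * p 1 1 = ρ * (p 0 1 + p 1 0) ∧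
  (ρ + γ) * p 0 1 = p 1 1

/-- `p` is a stationary distribution of the partial flexibility system. -/
def PartialStationary (ρ k γ : ℝ) (p : Fin 2 → Fin 3 → ℝ) : Prop :=
  (∀ m n, 0 ≤ p m n) ∧ (∑ m : Fin 2, ∑ n : Fin 3, p m n) = 1 ∧ PartialBalance ρ k γ p

/-- Throughput of the partial flexibility system. -/
noncomputable def Tps (ρ k : ℝ) (p : Fin 2 → Fin 3 → ℝ) : ℝ :=
  ρ * (1 - p 1 1 - p 1 2) + k*ρ * (1 - p 1 1 - p 1 2 - p 0 1 - p 0 2)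

/-- Throughput of the independent system. -/
noncomputable def Tis (ρ k : ℝ) : ℝ := ρ/(ρ+1) + k*ρ/(k*ρ+1)

/-- An unnormalised solution of the full flexibility balance equations, for arrival rates `a`, `b`
and non-dedicated service rate `g`. The state `(0, 0)` has positive weight, so it spans all
solutions. -/
noncomputable def fullWeight (a b g : ℝ) : Fin 3 → Fin 3 → ℝ :=
  ![![g^2*((2*a + 2*b + 4)*g^3 + (5*a^2 + 6*a*b + 14*a + 5*b^2 + 14*b + 8)*g^2 + (2*a^3 +
      6*a^2*b + 10*a^2 + 6*a*b^2 + 28*a*b + 14*a + 2*b^3 + 10*b^2 + 14*b + 4)*g + 2*a^3 +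
      6*a^2*b + 5*a^2 + 6*a*b^2 + 6*a*b + 2*a + 2*b^3 + 5*b^2 + 2*b),
      a*g*((2*a^2 + 2*a*b + 4*a)*g^2 + (a^3 + 3*a^2*b + 4*a^2 + 3*a*b^2 + 10*a*b + 4*a + b^3 +
      2*b^2)*g + a^3 + 3*a^2*b + 2*a^2 + 3*a*b^2 + b^3 + 2*b^2),
      b*g^2*((2*a + 2*b + 4)*g^3 + (3*a^2 + 6*a*b + 14*a + 3*b^2 + 10*b + 8)*g^2 + (a^3 +
      3*a^2*b + 8*a^2 + 3*a*b^2 + 18*a*b + 14*a + b^3 + 6*b^2 + 10*b + 4)*g + a^3 + 3*a^2*b +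
      5*a^2 + 3*a*b^2 + 4*a*b + 2*a + b^3 + 3*b^2 + 2*b)],
    ![a*g^2*((2*a + 2*b + 4)*g^3 + (3*a^2 + 6*a*b + 10*a + 3*b^2 + 14*b + 8)*g^2 + (a^3 +
      3*a^2*b + 6*a^2 + 3*a*b^2 + 18*a*b + 10*a + b^3 + 8*b^2 + 14*b + 4)*g + a^3 + 3*a^2*b +
      3*a^2 + 3*a*b^2 + 4*a*b + 2*a + b^3 + 5*b^2 + 2*b),
      a^2*g*((2*a + 2*b + 4)*g^3 + (3*a^2 + 6*a*b + 8*a + 3*b^2 + 12*b + 4)*g^2 + (a^3 + 3*a^2*b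
      + 5*a^2 + 3*a*b^2 + 14*a*b + 6*a + b^3 + 5*b^2 + 2*b)*g + a^3 + 3*a^2*b + 2*a^2 + 3*a*b^2
      + b^3 + 2*b^2),
      a*b*g^2*((2*a + 2*b + 4)*g^3 + (3*a^2 + 6*a*b + 12*a + 3*b^2 + 12*b + 8)*g^2 + (a^3 +
      3*a^2*b + 7*a^2 + 3*a*b^2 + 18*a*b + 12*a + b^3 + 7*b^2 + 12*b + 4)*g + a^3 + 3*a^2*b +
      4*a^2 + 3*a*b^2 + 4*a*b + 2*a + b^3 + 4*b^2 + 2*b)],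
    ![b*g*((2*a*b + 2*b^2 + 4*b)*g^2 + (a^3 + 3*a^2*b + 2*a^2 + 3*a*b^2 + 10*a*b + b^3 + 4*b^2 +
      4*b)*g + a^3 + 3*a^2*b + 2*a^2 + 3*a*b^2 + b^3 + 2*b^2),
      a*b*((a^2 + 2*a*b + 2*a + b^2 + 2*b)*g^2 + (a^3 + 3*a^2*b + 3*a^2 + 3*a*b^2 + 10*a*b + 2*a
      + b^3 + 3*b^2 + 2*b)*g + a^3 + 3*a^2*b + 2*a^2 + 3*a*b^2 + b^3 + 2*b^2),
      b^2*g*((2*a + 2*b + 4)*g^3 + (3*a^2 + 6*a*b + 12*a + 3*b^2 + 8*b + 4)*g^2 + (a^3 + 3*a^2*b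
      + 5*a^2 + 3*a*b^2 + 14*a*b + 2*a + b^3 + 5*b^2 + 6*b)*g + a^3 + 3*a^2*b + 2*a^2 + 3*a*b^2
      + b^3 + 2*b^2)]]

/-- An unnormalised solution of the partial flexibility balance equations, for arrival rates `a`,
`b` and non-dedicated service rate `g`. -/
noncomputable def partialWeight (a b g : ℝ) : Fin 2 → Fin 3 → ℝ :=
  ![![g*((a + b + 2)*g + 2*a^2 + a*b + 5*a + b + 2),
      a^2*(a + b + 2),
      b*g*((a + b + 2)*g + a^2 + a*b + 5*a + b + 2)],
    ![a*g*(a + b + 2)*(g + a + 1),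
      a^2*(a + b + 2)*(g + a),
      a*b*g*((a + b + 2)*g + a^2 + a*b + 4*a + b + 2)]]

/-- Total mass of `fullWeight`. -/
noncomputable def fullMass (a b g : ℝ) : ℝ := ∑ i, ∑ j, fullWeight a b g i j

/-- Total mass of `partialWeight`. -/
noncomputable def partialMass (a b g : ℝ) : ℝ := ∑ i, ∑ j, partialWeight a b g i j

/-- Throughput of the full flexibility system with respect to `fullWeight`. -/
noncomputable def fullFlow (a b g : ℝ) : ℝ :=
  (a + b) * (fullMass a b g - fullWeight a b g 1 1 - fullWeight a b g 1 2
    - fullWeight a b g 2 1 - fullWeight a b g 2 2)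

/-- Throughput of the partial flexibility system with respect to `partialWeight`. -/
noncomputable def partialFlow (a b g : ℝ) : ℝ :=
  a * (partialMass a b g - partialWeight a b g 1 1 - partialWeight a b g 1 2)
    + b * (partialMass a b g - partialWeight a b g 1 1 - partialWeight a b g 1 2
      - partialWeight a b g 0 1 - partialWeight a b g 0 2)

lemma fullBalance_fullWeight (ρ k γ : ℝ) : FullBalance ρ k γ (fullWeight ρ (k*ρ) γ) := by
  generalize hb : k*ρ = b
  simp only [FullBalance, hb, fullWeight, Matrix.cons_val]
  refine ⟨?_, ?_, ?_, ?_, ?_, ?_, ?_, ?_, ?_⟩ <;> ring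

lemma partialBalance_partialWeight (ρ k γ : ℝ) :
    PartialBalance ρ k γ (partialWeight ρ (k*ρ) γ) := by
  generalize hb : k*ρ = b
  simp only [PartialBalance, hb, partialWeight, Matrix.cons_val]
  refine ⟨?_, ?_, ?_, ?_, ?_, ?_⟩ <;> ring

lemma mul_abs_le_of_mul_eq_add {c d e x y z : ℝ} (hc : 0 ≤ c) (hd : 0 ≤ d) (he : 0 ≤ e)
    (h : c * x = d * y + e * z) : c * |x| ≤ d * |y| + e * |z| := by
  calc c * |x| = |d * y + e * z| := by rw [← h, abs_mul, abs_of_nonneg hc]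
    _ ≤ |d * y| + |e * z| := abs_add_le _ _
    _ = d * |y| + e * |z| := by rw [abs_mul, abs_mul, abs_of_nonneg hd, abs_of_nonneg he]

/-- The balance equations of the full flexibility system, with the idle state removed, are strictly
column diagonally dominant, so a solution vanishing at the idle state is zero. -/
lemma FullBalance.eq_zero {ρ k γ : ℝ} (hρ : 0 < ρ) (hk : 0 < k) (hγ : 0 < γ)
    {w : Fin 3 → Fin 3 → ℝ} (hw : FullBalance ρ k γ w) (h00 : w 0 0 = 0) (i j : Fin 3) :
    w i j = 0 := by
  obtain ⟨-, e10, e20, e01, e11, e21, e02, e12, e22⟩ := hw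
  have hb : 0 < k*ρ := mul_pos hk hρ
  generalize k*ρ = b at *
  rw [h00] at e10 e02
  have a10 := mul_abs_le_of_mul_eq_add (by positivity) hγ.le zero_le_one
    (show (ρ + b + 1) * w 1 0 = γ * w 1 1 + 1 * w 1 2 by linear_combination e10)
  have a20 := mul_abs_le_of_mul_eq_add (by positivity) hγ.le zero_le_one
    (show (ρ + b + γ) * w 2 0 = γ * w 2 1 + 1 * w 2 2 by linear_combination e20)
  have a01 := mul_abs_le_of_mul_eq_add (by positivity) zero_le_one hγ.le
    (show (ρ + b + γ) * w 0 1 = 1 * w 1 1 + γ * w 2 1 by linear_combination e01)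
  have a02 := mul_abs_le_of_mul_eq_add (by positivity) zero_le_one hγ.le
    (show (ρ + b + 1) * w 0 2 = 1 * w 1 2 + γ * w 2 2 by linear_combination e02)
  have a11 := mul_abs_le_of_mul_eq_add (by positivity) hρ.le hρ.le e11
  have a21 := mul_abs_le_of_mul_eq_add (by positivity) hρ.le hb.le e21
  have a12 := mul_abs_le_of_mul_eq_add (by positivity) hρ.le hb.le e12
  have a22 := mul_abs_le_of_mul_eq_add (by positivity) hb.le hb.le e22
  have key : |w 1 0| + |w 0 2| + γ * |w 2 0| + γ * |w 0 1| ≤ 0 := by linarith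
  have n20 := mul_nonneg hγ.le (abs_nonneg (w 2 0))
  have n01 := mul_nonneg hγ.le (abs_nonneg (w 0 1))
  have z10 : w 1 0 = 0 := abs_nonpos_iff.1 (by linarith [abs_nonneg (w 0 2)])
  have z02 : w 0 2 = 0 := abs_nonpos_iff.1 (by linarith [abs_nonneg (w 1 0)])
  have z20 : w 2 0 = 0 := abs_nonpos_iff.1 <| nonpos_of_mul_nonpos_right
    (by linarith [abs_nonneg (w 1 0), abs_nonneg (w 0 2)]) hγ
  have z01 : w 0 1 = 0 := abs_nonpos_iff.1 <| nonpos_of_mul_nonpos_right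
    (by linarith [abs_nonneg (w 1 0), abs_nonneg (w 0 2)]) hγ
  rw [z10, z01] at e11
  rw [z20, z01] at e21
  rw [z02, z10] at e12
  rw [z20, z02] at e22
  have z11 : w 1 1 = 0 := (mul_eq_zero_iff_left (by positivity)).1 (e11.trans (by ring))
  have z21 : w 2 1 = 0 := (mul_eq_zero_iff_left (by positivity)).1 (e21.trans (by ring))
  have z12 : w 1 2 = 0 := (mul_eq_zero_iff_left (by positivity)).1 (e12.trans (by ring))
  have z22 : w 2 2 = 0 := (mul_eq_zero_iff_left (by positivity)).1 (e22.trans (by ring))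
  fin_cases i <;> fin_cases j <;> assumption

/-- A solution of the partial flexibility balance equations vanishing at the idle state is zero. -/
lemma PartialBalance.eq_zero {ρ k γ : ℝ} (hρ : 0 < ρ) (hk : 0 < k) (hγ : 0 < γ)
    {w : Fin 2 → Fin 3 → ℝ} (hw : PartialBalance ρ k γ w) (h00 : w 0 0 = 0)
    (i : Fin 2) (j : Fin 3) : w i j = 0 := by
  obtain ⟨-, e10, e12, e02, e11, e01⟩ := hw
  have hb : 0 < k*ρ := mul_pos hk hρ
  generalize k*ρ = b at *
  rw [h00] at e10 e02
  have a10 := mul_abs_le_of_mul_eq_add (by positivity) hγ.le zero_le_one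
    (show (ρ + b + 1) * w 1 0 = γ * w 1 1 + 1 * w 1 2 by linear_combination e10)
  have a01 := mul_abs_le_of_mul_eq_add (by positivity) zero_le_one le_rfl
    (show (ρ + γ) * w 0 1 = 1 * w 1 1 + 0 * w 1 1 by linear_combination e01)
  have a02 := mul_abs_le_of_mul_eq_add (by positivity) zero_le_one le_rfl
    (show (ρ + 1) * w 0 2 = 1 * w 1 2 + 0 * w 1 2 by linear_combination e02)
  have a11 := mul_abs_le_of_mul_eq_add (by positivity) hρ.le hρ.le
    (show (1 + γ) * w 1 1 = ρ * w 0 1 + ρ * w 1 0 by linear_combination e11)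
  have a12 := mul_abs_le_of_mul_eq_add (by positivity) hρ.le hb.le e12
  have key : |w 1 0| + |w 0 2| + γ * |w 0 1| ≤ 0 := by linarith
  have n01 := mul_nonneg hγ.le (abs_nonneg (w 0 1))
  have z10 : w 1 0 = 0 := abs_nonpos_iff.1 (by linarith [abs_nonneg (w 0 2)])
  have z02 : w 0 2 = 0 := abs_nonpos_iff.1 (by linarith [abs_nonneg (w 1 0)])
  have z01 : w 0 1 = 0 := abs_nonpos_iff.1 <| nonpos_of_mul_nonpos_right
    (by linarith [abs_nonneg (w 1 0), abs_nonneg (w 0 2)]) hγ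
  have z11 : w 1 1 = 0 := by rw [← e01, z01, mul_zero]
  have z12 : w 1 2 = 0 := by
    rw [z02, z10] at e12
    linarith
  fin_cases i <;> fin_cases j <;> assumption

lemma fullWeight_pos {a b g : ℝ} (ha : 0 < a) (hb : 0 < b) (hg : 0 < g) (i j : Fin 3) :
    0 < fullWeight a b g i j := by
  fin_cases i <;> fin_cases j <;> simp only [fullWeight, Fin.zero_eta, Fin.mk_one,
    Fin.reduceFinMk, Matrix.cons_val] <;> positivity

lemma partialWeight_pos {a b g : ℝ} (ha : 0 < a) (hb : 0 < b) (hg : 0 < g)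
    (i : Fin 2) (j : Fin 3) : 0 < partialWeight a b g i j := by
  fin_cases i <;> fin_cases j <;> simp only [partialWeight, Fin.zero_eta, Fin.mk_one,
    Fin.reduceFinMk, Matrix.cons_val] <;> positivity

lemma fullMass_pos {a b g : ℝ} (ha : 0 < a) (hb : 0 < b) (hg : 0 < g) : 0 < fullMass a b g :=
  Finset.sum_pos (fun i _ => Finset.sum_pos (fun j _ => fullWeight_pos ha hb hg i j)
    Finset.univ_nonempty) Finset.univ_nonempty

lemma partialMass_pos {a b g : ℝ} (ha : 0 < a) (hb : 0 < b) (hg : 0 < g) :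
    0 < partialMass a b g :=
  Finset.sum_pos (fun i _ => Finset.sum_pos (fun j _ => partialWeight_pos ha hb hg i j)
    Finset.univ_nonempty) Finset.univ_nonempty

lemma FullStationary.mul_fullMass {ρ k γ : ℝ} (hρ : 0 < ρ) (hk : 0 < k) (hγ : 0 < γ)
    {π : Fin 3 → Fin 3 → ℝ} (hπ : FullStationary ρ k γ π) (i j : Fin 3) :
    π i j * fullMass ρ (k*ρ) γ = fullWeight ρ (k*ρ) γ i j := by
  obtain ⟨-, hsum, hbal⟩ := hπ
  have hF := fullBalance_fullWeight ρ k γ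
  have hpos := fullWeight_pos hρ (mul_pos hk hρ) hγ
  unfold fullMass
  generalize fullWeight ρ (k*ρ) γ = F at *
  have hprop (i j : Fin 3) : F 0 0 * π i j = π 0 0 * F i j := by
    refine sub_eq_zero.1 (FullBalance.eq_zero (w := fun i j => F 0 0 * π i j - π 0 0 * F i j)
      hρ hk hγ ?_ (by ring) i j)
    obtain ⟨h1, h2, h3, h4, h5, h6, h7, h8, h9⟩ := hbal
    obtain ⟨f1, f2, f3, f4, f5, f6, f7, f8, f9⟩ := hF
    exact ⟨by linear_combination F 0 0 * h1 - π 0 0 * f1,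
      by linear_combination F 0 0 * h2 - π 0 0 * f2, by linear_combination F 0 0 * h3 - π 0 0 * f3,
      by linear_combination F 0 0 * h4 - π 0 0 * f4, by linear_combination F 0 0 * h5 - π 0 0 * f5,
      by linear_combination F 0 0 * h6 - π 0 0 * f6, by linear_combination F 0 0 * h7 - π 0 0 * f7,
      by linear_combination F 0 0 * h8 - π 0 0 * f8, by linear_combination F 0 0 * h9 - π 0 0 * f9⟩
  have hmass : F 0 0 = π 0 0 * ∑ i, ∑ j, F i j := by
    calc F 0 0 = F 0 0 * ∑ i, ∑ j, π i j := by rw [hsum, mul_one]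
      _ = π 0 0 * ∑ i, ∑ j, F i j := by simp_rw [Finset.mul_sum, hprop]
  refine mul_left_cancel₀ (hpos 0 0).ne' ?_
  linear_combination (∑ i, ∑ j, F i j) * hprop i j - F i j * hmass

lemma PartialStationary.mul_partialMass {ρ k γ : ℝ} (hρ : 0 < ρ) (hk : 0 < k) (hγ : 0 < γ)
    {p : Fin 2 → Fin 3 → ℝ} (hp : PartialStationary ρ k γ p) (i : Fin 2) (j : Fin 3) :
    p i j * partialMass ρ (k*ρ) γ = partialWeight ρ (k*ρ) γ i j := by
  obtain ⟨-, hsum, hbal⟩ := hp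
  have hF := partialBalance_partialWeight ρ k γ
  have hpos := partialWeight_pos hρ (mul_pos hk hρ) hγ
  unfold partialMass
  generalize partialWeight ρ (k*ρ) γ = F at *
  have hprop (i : Fin 2) (j : Fin 3) : F 0 0 * p i j = p 0 0 * F i j := by
    refine sub_eq_zero.1 (PartialBalance.eq_zero (w := fun i j => F 0 0 * p i j - p 0 0 * F i j)
      hρ hk hγ ?_ (by ring) i j)
    obtain ⟨h1, h2, h3, h4, h5, h6⟩ := hbal
    obtain ⟨f1, f2, f3, f4, f5, f6⟩ := hF
    exact ⟨by linear_combination F 0 0 * h1 - p 0 0 * f1,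
      by linear_combination F 0 0 * h2 - p 0 0 * f2, by linear_combination F 0 0 * h3 - p 0 0 * f3,
      by linear_combination F 0 0 * h4 - p 0 0 * f4, by linear_combination F 0 0 * h5 - p 0 0 * f5,
      by linear_combination F 0 0 * h6 - p 0 0 * f6⟩
  have hmass : F 0 0 = p 0 0 * ∑ i, ∑ j, F i j := by
    calc F 0 0 = F 0 0 * ∑ i, ∑ j, p i j := by rw [hsum, mul_one]
      _ = p 0 0 * ∑ i, ∑ j, F i j := by simp_rw [Finset.mul_sum, hprop]
  refine mul_left_cancel₀ (hpos 0 0).ne' ?_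
  linear_combination (∑ i, ∑ j, F i j) * hprop i j - F i j * hmass

lemma FullStationary.Tfs_eq {ρ k γ : ℝ} (hρ : 0 < ρ) (hk : 0 < k) (hγ : 0 < γ)
    {π : Fin 3 → Fin 3 → ℝ} (hπ : FullStationary ρ k γ π) :
    Tfs ρ k π = fullFlow ρ (k*ρ) γ / fullMass ρ (k*ρ) γ := by
  rw [eq_div_iff (fullMass_pos hρ (mul_pos hk hρ) hγ).ne', fullFlow]
  simp only [← hπ.mul_fullMass hρ hk hγ, Tfs]
  ring

lemma PartialStationary.Tps_eq {ρ k γ : ℝ} (hρ : 0 < ρ) (hk : 0 < k) (hγ : 0 < γ)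
    {p : Fin 2 → Fin 3 → ℝ} (hp : PartialStationary ρ k γ p) :
    Tps ρ k p = partialFlow ρ (k*ρ) γ / partialMass ρ (k*ρ) γ := by
  rw [eq_div_iff (partialMass_pos hρ (mul_pos hk hρ) hγ).ne', partialFlow]
  simp only [← hp.mul_partialMass hρ hk hγ, Tps]
  ring

/-- A polynomial whose coefficients change sign only once, around degree two, is negative to the
left of any positive root. -/
lemma neg_of_lt_root_of_sign_change {c₀ c₁ c₂ c₃ c₄ c₅ c₆ c₇ x y : ℝ} (h₀ : 0 < c₀) (h₁ : 0 < c₁)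
    (h₃ : 0 < c₃) (h₄ : 0 < c₄) (h₅ : 0 < c₅) (h₆ : 0 < c₆) (h₇ : 0 < c₇) (hx : 0 < x) (hxy : x < y)
    (hy : -(c₀ + c₁*y) + c₂*y^2 + c₃*y^3 + c₄*y^4 + c₅*y^5 + c₆*y^6 + c₇*y^7 = 0) :
    -(c₀ + c₁*x) + c₂*x^2 + c₃*x^3 + c₄*x^4 + c₅*x^5 + c₆*x^6 + c₇*x^7 < 0 := by
  have hy0 : 0 < y := hx.trans hxy
  have hpow (n : ℕ) (hn : n ≠ 0) : 0 < y^n - x^n := sub_pos.2 (pow_lt_pow_left₀ hxy hx.le hn)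
  have d₁ := hpow 1 (by norm_num)
  have d₂ := hpow 2 (by norm_num)
  have d₃ := hpow 3 (by norm_num)
  have d₄ := hpow 4 (by norm_num)
  have d₅ := hpow 5 (by norm_num)
  have key : 0 < c₀*(y^2 - x^2) + c₁*(x*y)*(y^1 - x^1) + x^2*y^2*(c₃*(y^1 - x^1) + c₄*(y^2 - x^2)
      + c₅*(y^3 - x^3) + c₆*(y^4 - x^4) + c₇*(y^5 - x^5)) := by positivity
  refine neg_of_mul_neg_right (a := y^2) ?_ (by positivity)
  linear_combination key + x^2 * hy

set_option maxHeartbeats 1000000 in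
set_option maxRecDepth 2000 in
/-- The cross-multiplied throughput difference is, up to a positive factor, a polynomial in `g`
whose coefficients change sign only once. -/
lemma exists_sign_change_throughput_difference {a b : ℝ} (ha : 0 < a) (hb : 0 < b) :
    ∃ c₀ c₁ c₂ c₃ c₄ c₅ c₆ c₇ : ℝ, 0 < c₀ ∧ 0 < c₁ ∧ 0 < c₃ ∧ 0 < c₄ ∧ 0 < c₅ ∧ 0 < c₆ ∧ 0 < c₇ ∧
      ∀ g, fullFlow a b g * partialMass a b g - partialFlow a b g * fullMass a b g =
        b * (-(c₀ + c₁*g) + c₂*g^2 + c₃*g^3 + c₄*g^4 + c₅*g^5 + c₆*g^6 + c₇*g^7) := by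
  refine ⟨a^8 + (4*b + 4)*a^7 + (6*b^2 + 8*b + 4)*a^6 + (4*b^3 + 8*b^2)*a^5 + (b^4 + 4*b^3 +
      4*b^2)*a^4,
    (2*b + 3)*a^7 + (8*b^2 + 31*b + 13)*a^6 + (12*b^3 + 53*b^2 + 67*b + 16)*a^5 + (8*b^4 +
      43*b^3 + 52*b^2 + 28*b + 4)*a^4 + (2*b^5 + 20*b^4 + 52*b^3 + 24*b^2 + 4*b)*a^3 +
      (2*b^5 + 15*b^4 + 24*b^3 + 4*b^2)*a^2 + (b^5 + 4*b^4 + 4*b^3)*a,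
    a^8 + (4*b + 5)*a^7 + (5*b^2 + 15*b + 9)*a^6 + (-17*b^2 - 10*b + 8)*a^5 + (-5*b^4 -
      44*b^3 - 134*b^2 - 67*b + 4)*a^4 - (4*b^5 + 27*b^4 + 68*b^3 + 119*b^2 + 40*b)*a^3 -
      (b^6 + 11*b^5 + 31*b^4 + 41*b^3 + 32*b^2 + 4*b)*a^2 - (b^6 + 6*b^5 + 13*b^4 + 12*b^3 +
      4*b^2)*a,
    (2*b + 4)*a^7 + (8*b^2 + 29*b + 22)*a^6 + (12*b^3 + 72*b^2 + 101*b + 46)*a^5 + (8*b^4 +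
      58*b^3 + 168*b^2 + 160*b + 50)*a^4 + (2*b^5 + 12*b^4 + 41*b^3 + 124*b^2 + 137*b +
      32)*a^3 + (b^5 + 13*b^4 + 26*b^3 + 41*b^2 + 52*b + 8)*a^2 + (6*b^5 + 22*b^4 + 23*b^3 +
      8*b^2 + 4*b)*a + b^6 + 6*b^5 + 13*b^4 + 12*b^3 + 4*b^2,
    (b^2 + 7*b + 4)*a^6 + (4*b^3 + 32*b^2 + 63*b + 24)*a^5 + (6*b^4 + 60*b^3 + 173*b^2 +
      176*b + 52)*a^4 + (4*b^5 + 50*b^4 + 205*b^3 + 351*b^2 + 235*b + 48)*a^3 + (b^6 +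
      17*b^5 + 97*b^4 + 269*b^3 + 337*b^2 + 166*b + 16)*a^2 + (2*b^6 + 24*b^5 + 101*b^4 +
      189*b^3 + 160*b^2 + 52*b)*a + 2*b^6 + 15*b^5 + 43*b^4 + 58*b^3 + 36*b^2 + 8*b,
    (4*b^2 + 11*b + 2)*a^5 + (13*b^3 + 60*b^2 + 72*b + 10)*a^4 + (15*b^4 + 105*b^3 + 228*b^2
      + 165*b + 16)*a^3 + (7*b^5 + 71*b^4 + 252*b^3 + 365*b^2 + 186*b + 8)*a^2 + (b^6 +
      16*b^5 + 98*b^4 + 251*b^3 + 276*b^2 + 108*b)*a + b^6 + 12*b^5 + 49*b^4 + 90*b^3 +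
      76*b^2 + 24*b,
    (5*b^2 + 7*b)*a^4 + (13*b^3 + 50*b^2 + 41*b)*a^3 + (11*b^4 + 70*b^3 + 143*b^2 +
      86*b)*a^2 + (3*b^5 + 30*b^4 + 107*b^3 + 156*b^2 + 76*b)*a + 3*b^5 + 21*b^4 + 54*b^3 +
      60*b^2 + 24*b,
    (2*b^2 + 2*b)*a^3 + (4*b^3 + 14*b^2 + 10*b)*a^2 + (2*b^4 + 14*b^3 + 28*b^2 + 16*b)*a +
      2*b^4 + 10*b^3 + 16*b^2 + 8*b,
    by positivity, by positivity, by positivity, by positivity, by positivity, by positivity,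
    by positivity, fun g => ?_⟩
  simp only [fullFlow, fullMass, partialFlow, partialMass, fullWeight, partialWeight,
    Fin.sum_univ_two, Fin.sum_univ_three, Matrix.cons_val]
  ring

lemma Tis_lt_partialFlow_div {ρ k γ : ℝ} (hρ : 0 < ρ) (hk : 0 < k)
    (hγ : k*ρ/(k*ρ + 1) < γ) :
    Tis ρ k < partialFlow ρ (k*ρ) γ / partialMass ρ (k*ρ) γ := by
  have hb : 0 < k*ρ := mul_pos hk hρ
  unfold Tis
  generalize k*ρ = b at *
  have hγ0 : 0 < γ := lt_trans (by positivity) hγ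
  have hgap : 0 < γ * (b + 1) - b := sub_pos.2 ((div_lt_iff₀ (by positivity)).1 hγ)
  rw [div_add_div _ _ (by positivity) (by positivity),
    div_lt_div_iff₀ (by positivity) (partialMass_pos hρ hb hγ0), ← sub_pos]
  have key : 0 < ρ^2 * (ρ + 1) * (ρ + b + 2) * (ρ + γ + 1) * (γ * (b + 1) - b) := by positivity
  refine key.trans_eq ?_
  simp only [partialFlow, partialMass, partialWeight, Fin.sum_univ_two, Fin.sum_univ_three,
    Matrix.cons_val]
  ring

/-- for `γ ∈ (kρ/(kρ+1), γ^r)` the partial flexibility system is optimal: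
`T_ps > T_fs` and `T_ps > T_is`. -/
theorem stmt_19 (ρ k : ℝ) (hρ : 0 < ρ) (hk : k ∈ Set.Ioo (0:ℝ) 1)
    (γr : ℝ) (hγr : γr ∈ Set.Ioo (0:ℝ) 1)
    (hr : ∃ (πr : Fin 3 → Fin 3 → ℝ) (pr : Fin 2 → Fin 3 → ℝ),
      FullStationary ρ k γr πr ∧ PartialStationary ρ k γr pr ∧ Tfs ρ k πr = Tps ρ k pr)
    (γ : ℝ) (hγ : k*ρ/(k*ρ + 1) < γ) (hγ' : γ < γr)
    (π : Fin 3 → Fin 3 → ℝ) (p : Fin 2 → Fin 3 → ℝ)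
    (hπ : FullStationary ρ k γ π) (hp : PartialStationary ρ k γ p) :
    Tps ρ k p > Tfs ρ k π ∧ Tps ρ k p > Tis ρ k := by
  obtain ⟨hk, -⟩ := hk
  have hb : 0 < k*ρ := mul_pos hk hρ
  have hγ0 : 0 < γ := lt_trans (by positivity) hγ
  have hγr0 : 0 < γr := hγr.1
  obtain ⟨πr, pr, hπr, hpr, heq⟩ := hr
  rw [hπr.Tfs_eq hρ hk hγr0, hpr.Tps_eq hρ hk hγr0,
    div_eq_div_iff (fullMass_pos hρ hb hγr0).ne' (partialMass_pos hρ hb hγr0).ne'] at heq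
  rw [hπ.Tfs_eq hρ hk hγ0, hp.Tps_eq hρ hk hγ0]
  refine ⟨?_, Tis_lt_partialFlow_div hρ hk hγ⟩
  obtain ⟨c₀, c₁, c₂, c₃, c₄, c₅, c₆, c₇, h₀, h₁, h₃, h₄, h₅, h₆, h₇, hdiff⟩ :=
    exists_sign_change_throughput_difference hρ hb
  have hroot := hdiff γr
  rw [sub_eq_zero.2 heq, eq_comm, mul_eq_zero_iff_left hb.ne'] at hroot
  have hneg := neg_of_lt_root_of_sign_change h₀ h₁ h₃ h₄ h₅ h₆ h₇ hγ0 hγ' hroot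
  rw [gt_iff_lt, div_lt_div_iff₀ (fullMass_pos hρ hb hγ0) (partialMass_pos hρ hb hγ0), ← sub_neg,
    hdiff γ]
  exact mul_neg_of_pos_of_neg hb hneg
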